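/- Let G be a finite simple graph on n vertices, let I ⊆ V(G) be an irredundant set of G, and let M be any matching of G. Then |M| + |I| ≤ n. In particular, IR(G) + ν(G) ≤ n, where ν(G) is the maximum size of a matching in G. -/

import Mathlib

/-- A set `I` of vertices is *irredundant* in `G` if every `v ∈ I` either has no
neighbor in `I`, or has a private neighbor: a vertex `u ∉ I` adjacent to `v`
whose only neighbor in `I` is `v`. -/
def Irredundant {V : Type*} (G : SimpleGraph V) (I : Set V) : Prop :=
  ∀ v ∈ I, (∀ u ∈ I, ¬ G.Adj v u) ∨
    ∃ u, u ∉ I ∧ G.Adj u v ∧ ∀ w ∈ I, G.Adj u w → w = v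

/-- A *matching* of `G`: a set of edges of `G` that are pairwise vertex-disjoint. -/
def IsMatchingSet {V : Type*} (G : SimpleGraph V) (M : Set (Sym2 V)) : Prop :=
  M ⊆ G.edgeSet ∧ ∀ e ∈ M, ∀ e' ∈ M, e ≠ e' → ∀ v : V, v ∈ e → v ∉ e'

/-- `IR(G)`: the maximum cardinality of an irredundant set of `G`. -/
noncomputable def irUpper {V : Type*} [Fintype V] (G : SimpleGraph V) : ℕ :=
  sSup {n | ∃ I : Set V, Irredundant G I ∧ I.ncard = n}

/-- `ν(G)`: the maximum cardinality of a matching of `G`. -/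
noncomputable def matchingNum {V : Type*} [Fintype V] (G : SimpleGraph V) : ℕ :=
  sSup {m | ∃ M : Set (Sym2 V), IsMatchingSet G M ∧ M.ncard = m}

open Classical in
/-- A matching covers exactly twice as many vertices as it has edges. -/
theorem IsMatchingSet.card_covered {V : Type*} [Fintype V] {G : SimpleGraph V}
    {M : Set (Sym2 V)} (hM : IsMatchingSet G M) :
    (M.toFinset.biUnion Sym2.toFinset).card = 2 * M.ncard := by
  rw [Finset.card_biUnion, Finset.sum_congr rfl (g := fun _ => 2), Finset.sum_const,
    Set.ncard_eq_toFinset_card', smul_eq_mul, mul_comm]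
  · intro e he
    exact Sym2.card_toFinset_of_not_isDiag e
      (G.not_isDiag_of_mem_edgeSet (hM.1 (Set.mem_toFinset.1 he)))
  · intro e he e' he' hne
    rw [Function.onFun, Finset.disjoint_left]
    intro v hv hv'
    rw [Sym2.mem_toFinset] at hv hv'
    exact hM.2 e (Set.mem_toFinset.1 he) e' (Set.mem_toFinset.1 he') hne v hv hv'

/-- A matched vertex of an irredundant set `I` has a neighbor outside `I` that is either its
partner in the matching or a private neighbor. -/
theorem Irredundant.exists_partner_or_private {V : Type*} {G : SimpleGraph V} {I : Set V}
    {M : Set (Sym2 V)} (hI : Irredundant G I) (hM : M ⊆ G.edgeSet) {v : V} (hv : v ∈ I)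
    {e : Sym2 V} (he : e ∈ M) (hve : v ∈ e) :
    ∃ u, u ∉ I ∧ G.Adj u v ∧ (s(v, u) ∈ M ∨ ∀ w ∈ I, G.Adj u w → w = v) := by
  obtain ⟨x, rfl⟩ := hve
  have hadj : G.Adj v x := hM he
  by_cases hx : x ∈ I
  · rcases hI v hv with h | ⟨u, hu, huv, h⟩
    · exact absurd hadj (h x hx)
    · exact ⟨u, hu, huv, Or.inr h⟩
  · exact ⟨x, hx, hadj.symm, Or.inl he⟩

open Classical in
/-- An irredundant set has at most as many matched vertices as its complement has vertices. -/
theorem Irredundant.card_filter_covered_le {V : Type*} [Fintype V] {G : SimpleGraph V}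
    {I : Set V} {M : Set (Sym2 V)} (hI : Irredundant G I) (hM : IsMatchingSet G M) :
    ((M.toFinset.biUnion Sym2.toFinset).filter (· ∈ I)).card ≤ I.toFinsetᶜ.card := by
  have key : ∀ v ∈ (M.toFinset.biUnion Sym2.toFinset).filter (· ∈ I),
      ∃ u, u ∉ I ∧ G.Adj u v ∧ (s(v, u) ∈ M ∨ ∀ w ∈ I, G.Adj u w → w = v) := by
    intro v hv
    simp only [Finset.mem_filter, Finset.mem_biUnion, Set.mem_toFinset, Sym2.mem_toFinset] at hv
    obtain ⟨⟨e, he, hve⟩, hvI⟩ := hv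
    exact hI.exists_partner_or_private hM.1 hvI he hve
  choose! f hf hadj hor using key
  refine Finset.card_le_card_of_injOn f (fun v hv => by simpa using hf v hv) ?_
  intro v hv w hw hvw
  have hvI : v ∈ I := (Finset.mem_filter.1 hv).2
  have hwI : w ∈ I := (Finset.mem_filter.1 hw).2
  have hv' := hadj v hv
  have hw' := hadj w hw
  rcases hor v hv with h | h
  · rcases hor w hw with h' | h'
    · by_contra hne
      rw [← hvw] at h'
      refine hM.2 _ h _ h' (fun heq => hne ?_) (f v) (Sym2.mem_mk_right _ _)
        (Sym2.mem_mk_right _ _)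
      exact Sym2.congr_left.1 heq
    · exact h' v hvI (hvw ▸ hv')
  · exact (h w hwI (hvw ▸ hw')).symm

/-- The inequality for a single irredundant set and a single matching. -/
theorem Irredundant.ncard_matching_add_ncard_le {V : Type*} [Fintype V] {G : SimpleGraph V}
    {I : Set V} {M : Set (Sym2 V)} (hI : Irredundant G I) (hM : IsMatchingSet G M) :
    M.ncard + I.ncard ≤ Fintype.card V := by
  classical
  have hS := hM.card_covered
  have hin := hI.card_filter_covered_le hM
  have hout : ((M.toFinset.biUnion Sym2.toFinset).filter (· ∉ I)).card ≤ I.toFinsetᶜ.card :=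
    Finset.card_le_card fun v hv => by simpa using (Finset.mem_filter.1 hv).2
  have hsplit := Finset.card_filter_add_card_filter_not (s := M.toFinset.biUnion Sym2.toFinset)
    (· ∈ I)
  have hcompl := Finset.card_add_card_compl I.toFinset
  rw [Set.ncard_eq_toFinset_card' I]
  omega

/-- for any irredundant set `I` and any matching `M` of `G`,
`|M| + |I| ≤ n`; in particular `IR(G) + ν(G) ≤ n`. -/
theorem matching_plus_irredundant_le {V : Type*} [Fintype V] (G : SimpleGraph V)
    (I : Set V) (M : Set (Sym2 V))
    (hI : Irredundant G I) (hM : IsMatchingSet G M) :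
    M.ncard + I.ncard ≤ Fintype.card V ∧
    irUpper G + matchingNum G ≤ Fintype.card V := by
  refine ⟨hI.ncard_matching_add_ncard_le hM, ?_⟩
  have hI₀ : Irredundant G ∅ := fun v hv => absurd hv (Set.notMem_empty v)
  have hM₀ : IsMatchingSet G ∅ := ⟨Set.empty_subset _, fun e he => absurd he (Set.notMem_empty e)⟩
  obtain ⟨J, hJ, hJcard⟩ : irUpper G ∈ {n | ∃ I : Set V, Irredundant G I ∧ I.ncard = n} := by
    refine Nat.sSup_mem ⟨_, ∅, hI₀, rfl⟩ ⟨Fintype.card V, ?_⟩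
    rintro _ ⟨K, hK, rfl⟩
    exact le_of_add_le_right (hK.ncard_matching_add_ncard_le hM₀)
  obtain ⟨N, hN, hNcard⟩ :
      matchingNum G ∈ {m | ∃ M : Set (Sym2 V), IsMatchingSet G M ∧ M.ncard = m} := by
    refine Nat.sSup_mem ⟨_, ∅, hM₀, rfl⟩ ⟨Fintype.card V, ?_⟩
    rintro _ ⟨N, hN, rfl⟩
    exact le_of_add_le_left (hI₀.ncard_matching_add_ncard_le hN)
  rw [← hJcard, ← hNcard, add_comm]
  exact hJ.ncard_matching_add_ncard_le hN
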